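/- Let G be a finite multigraph and t ≥ 1 an integer. Then, as an identity of rational functions in y, T_Ĝ(1 + 1/y, y) = ((y^t − 1)/(y − 1))^{v(G)−c(G)} · T_G((y^{t+1} − 1)/(y^{t+1} − y), y^t). -/

import Mathlib

open MvPolynomial

namespace ForestAlg

variable {V E : Type*}

/-- Two vertices are directly connected by an edge of `A`. -/
def edgeRel (ends : E → Sym2 V) (A : Finset E) (v w : V) : Prop :=
  ∃ e ∈ A, ends e = s(v, w)

/-- Number of connected components of the spanning subgraph `(V, A)`. -/
noncomputable def numComponents (ends : E → Sym2 V) (A : Finset E) : ℕ :=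
  Nat.card (Quot (edgeRel ends A))

/-- Rank `r(A) = v(G) - c(V,A)`. -/
noncomputable def rank (ends : E → Sym2 V) (A : Finset E) : ℕ :=
  Nat.card V - numComponents ends A

/-- `A` is a subforest (contains no cycle): `|A| = v(G) - c(V,A)`. -/
def IsForest (ends : E → Sym2 V) (A : Finset E) : Prop :=
  A.card + numComponents ends A = Nat.card V

/-- The Tutte polynomial, evaluated at `(x, y)`. -/
noncomputable def tutte [Fintype E] {R : Type*} [CommRing R]
    (ends : E → Sym2 V) (x y : R) : R :=
  ∑ A ∈ (Finset.univ : Finset E).powerset,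
    (x - 1) ^ (rank ends Finset.univ - rank ends A) *
      (y - 1) ^ (A.card - rank ends A)

/-- `e ∉ F` is externally active for the subforest `F` with respect to the linear
order `o`: `F + e` contains a cycle and `e` is the minimal edge of that cycle
(the edges of the unique cycle of `F + e` are those whose removal does not
decrease the rank). -/
def ExtActive [DecidableEq E] (o : LinearOrder E) (ends : E → Sym2 V)
    (F : Finset E) (e : E) : Prop :=
  e ∉ F ∧ ¬ IsForest ends (insert e F) ∧
    ∀ f ∈ insert e F,
      rank ends ((insert e F).erase f) = rank ends (insert e F) → o.le e f

/-- External activity `act_G(F)`. -/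
noncomputable def act [DecidableEq E] (o : LinearOrder E) (ends : E → Sym2 V)
    (F : Finset E) : ℕ :=
  Set.ncard {e : E | ExtActive o ends F e}

/-- `D_I`: number of edges with one endpoint in `I` and the other outside `I`. -/
noncomputable def crossCount {n : ℕ} (ends : E → Sym2 (Fin n))
    (I : Finset (Fin n)) : ℕ :=
  Set.ncard {e : E | (∃ v ∈ ends e, v ∈ I) ∧ ∃ w ∈ ends e, w ∉ I}

/-- The ideal `J_G^{F_t}` generated by `(∑_{i ∈ I} x_i)^{t·D_I + 1}` over nonempty `I`. -/
noncomputable def forestIdeal (K : Type*) [Field K] {n : ℕ} (t : ℕ)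
    (ends : E → Sym2 (Fin n)) : Ideal (MvPolynomial (Fin n) K) :=
  Ideal.span {p | ∃ I : Finset (Fin n), I.Nonempty ∧
    p = (∑ i ∈ I, X i) ^ (t * crossCount ends I + 1)}

/-- The `k`-th graded component of `K[x_1,…,x_n]/J` (for homogeneous `J`):
the image of the degree-`k` homogeneous part in the quotient. -/
noncomputable def gradedPiece (K : Type*) [Field K] {n : ℕ}
    (J : Ideal (MvPolynomial (Fin n) K)) (k : ℕ) :
    Submodule K (MvPolynomial (Fin n) K ⧸ J) :=
  Submodule.map (Ideal.Quotient.mkₐ K J).toLinearMap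
    (homogeneousSubmodule (Fin n) K k)

/-- Dimension of the `k`-th graded component of the quotient. -/
noncomputable def gradedDim (K : Type*) [Field K] {n : ℕ}
    (J : Ideal (MvPolynomial (Fin n) K)) (k : ℕ) : ℕ :=
  Module.finrank K (gradedPiece K J k)


theorem edgeRel_mono (ends : E → Sym2 V) {A B : Finset E} (h : A ⊆ B) {v w : V}
    (hvw : edgeRel ends A v w) : edgeRel ends B v w :=
  let ⟨e, he, hes⟩ := hvw
  ⟨e, h he, hes⟩

theorem numComponents_anti [Finite V] (ends : E → Sym2 V) {A B : Finset E} (h : A ⊆ B) :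
    numComponents ends B ≤ numComponents ends A := by
  refine Nat.card_le_card_of_surjective
    (Quot.map id fun _ _ => edgeRel_mono ends h) ?_
  rintro ⟨v⟩
  exact ⟨Quot.mk _ v, rfl⟩

theorem rank_mono [Finite V] (ends : E → Sym2 V) {A B : Finset E} (h : A ⊆ B) :
    rank ends A ≤ rank ends B :=
  Nat.sub_le_sub_left (numComponents_anti ends h) _

theorem numComponents_empty (ends : E → Sym2 V) :
    numComponents ends ∅ = Nat.card V := by
  refine (Nat.card_congr (Equiv.ofBijective (Quot.mk (edgeRel ends ∅)) ⟨?_, ?_⟩)).symm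
  · intro v w h
    exact congrArg (Quot.lift id fun _ _ ⟨_, he, _⟩ => absurd he (Finset.notMem_empty _)) h
  · exact Quot.mk_surjective

theorem numComponents_le_insert [Finite V] [DecidableEq E] (ends : E → Sym2 V) (A : Finset E)
    (e : E) : numComponents ends A ≤ numComponents ends (insert e A) + 1 := by
  classical
  obtain ⟨a, b, hab⟩ : ∃ a b, ends e = s(a, b) := by
    induction h : ends e with | _ a b => exact ⟨a, b, rfl⟩
  let merge : V → Quot (edgeRel ends A) := fun v =>
    if Quot.mk (edgeRel ends A) v = Quot.mk _ b then Quot.mk _ a else Quot.mk _ v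
  have hmerge : ∀ v w, edgeRel ends (insert e A) v w → merge v = merge w := by
    rintro v w ⟨f, hf, hfe⟩
    rcases Finset.mem_insert.1 hf with rfl | hf
    · rw [hab, Sym2.eq_iff] at hfe
      rcases hfe with ⟨rfl, rfl⟩ | ⟨rfl, rfl⟩ <;> simp [merge]
    · have h : Quot.mk (edgeRel ends A) v = Quot.mk _ w := Quot.sound ⟨f, hf, hfe⟩
      simp only [merge, h]
  unfold numComponents
  rw [← Finite.card_option]
  refine Nat.card_le_card_of_surjective
    (fun o : Option (Quot (edgeRel ends (insert e A))) =>
      o.elim (Quot.mk _ b) (Quot.lift merge hmerge)) ?_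
  rintro ⟨v⟩
  by_cases h : Quot.mk (edgeRel ends A) v = Quot.mk _ b
  · exact ⟨none, h.symm⟩
  · exact ⟨some (Quot.mk _ v), if_neg h⟩

theorem rank_le_card [Finite V] (ends : E → Sym2 V) (A : Finset E) :
    rank ends A ≤ A.card := by
  classical
  have h : Nat.card V ≤ A.card + numComponents ends A := by
    induction A using Finset.induction_on with
    | empty => simp [numComponents_empty]
    | insert e A he ih =>
      have := numComponents_le_insert ends A e
      rw [Finset.card_insert_of_notMem he]
      omega
  unfold rank
  omega

/-- Parallel edges do not affect ranks. -/
theorem rank_comp {F : Type*} [DecidableEq E] (ends : E → Sym2 V) (p : F → E) (A : Finset F) :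
    rank (fun f => ends (p f)) A = rank ends (A.image p) := by
  have h : edgeRel (fun f => ends (p f)) A = edgeRel ends (A.image p) := by
    ext v w
    simp [edgeRel]
  unfold rank numComponents
  rw [h]

theorem sum_nonempty_pow_card {R : Type*} [CommRing R] (α : Type*) [Fintype α] [DecidableEq α]
    (z : R) :
    ∑ S ∈ (Finset.univ : Finset (Finset α)).erase ∅, z ^ S.card
      = (z + 1) ^ Fintype.card α - 1 := by
  rw [Finset.sum_erase_eq_sub (Finset.mem_univ _)]
  have h := Fintype.sum_pow_mul_eq_add_pow α z 1
  simp only [one_pow, mul_one] at h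
  simp [h]

/-- The generating function, by cardinality, of the sets of edges of the `α`-fold
multiplied graph that lie over exactly `B`. -/
theorem sum_pow_card_of_image_fst_eq {R : Type*} [CommRing R] {α : Type*} [Fintype E]
    [DecidableEq E] [Fintype α] [DecidableEq α] (z : R) (B : Finset E) :
    ∑ A : Finset (E × α) with A.image Prod.fst = B, z ^ A.card
      = ((z + 1) ^ Fintype.card α - 1) ^ B.card := by
  let T : E → Finset (Finset α) := fun e => if e ∈ B then Finset.univ.erase ∅ else {∅}
  have hT : ∏ e, ∑ S ∈ T e, z ^ S.card = ((z + 1) ^ Fintype.card α - 1) ^ B.card := by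
    have : ∀ e, ∑ S ∈ T e, z ^ S.card
        = if e ∈ B then (z + 1) ^ Fintype.card α - 1 else 1 := by
      intro e
      by_cases he : e ∈ B
      · simp only [T, he, if_true, sum_nonempty_pow_card]
      · simp [T, he]
    simp [this, Finset.prod_ite_mem]
  rw [← hT, Finset.prod_univ_sum]
  refine Finset.sum_nbij' (fun A e => {i | (e, i) ∈ A})
    (fun q => Finset.univ.filter fun x : E × α => x.2 ∈ q x.1) ?_ ?_ ?_ ?_ ?_
  · intro A hA
    obtain rfl := (Finset.mem_filter.1 hA).2
    refine Fintype.mem_piFinset.2 fun e => ?_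
    by_cases he : e ∈ A.image Prod.fst
    · simp only [T, he, if_true]
      simpa [Finset.eq_empty_iff_forall_notMem] using he
    · simp only [T, he, if_false]
      simpa [Finset.eq_empty_iff_forall_notMem] using he
  · intro q hq
    rw [Fintype.mem_piFinset] at hq
    refine Finset.mem_filter.2 ⟨Finset.mem_univ _, ?_⟩
    ext e
    have := hq e
    by_cases he : e ∈ B
    · simp only [T, he, if_true, Finset.mem_erase, ← Finset.nonempty_iff_ne_empty] at this
      simpa [he, Finset.Nonempty] using this.1
    · simp only [T, he, if_false, Finset.mem_singleton] at this
      simp [he, this]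
  · intro A _
    ext ⟨e, i⟩
    simp
  · intro q _
    ext e i
    simp
  · intro A _
    rw [Finset.prod_pow_eq_pow_sum]
    congr 1
    rw [Finset.card_eq_sum_card_fiberwise (f := Prod.fst) (t := Finset.univ) (by simp)]
    refine Finset.sum_congr rfl fun e _ => ?_
    refine Finset.card_nbij' (fun x => x.2) (fun i => (e, i)) ?_ ?_ ?_ ?_
    · rintro ⟨a, i⟩ h
      simp only [Finset.coe_filter, Set.mem_ofPred_eq] at h
      obtain ⟨h, rfl⟩ := h
      simpa using h
    · intro i h
      simpa using h
    · rintro ⟨a, i⟩ h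
      simp only [Finset.coe_filter, Set.mem_ofPred_eq] at h
      obtain ⟨_, rfl⟩ := h
      rfl
    · intro i _
      rfl

theorem tutte_parallel_eq {K : Type*} [Field K] [Finite V] [Fintype E] {t : ℕ} (ht : 1 ≤ t)
    (ends : E → Sym2 V) {y : K} (hy0 : y ≠ 0) (hy1 : y - 1 ≠ 0) (hyt : y ^ t - 1 ≠ 0) :
    tutte (V := V) (fun p : E × Fin t => ends p.1) (1 + 1 / y) y
      = ((y ^ t - 1) / (y - 1)) ^ rank ends Finset.univ
        * tutte ends ((y ^ (t + 1) - 1) / (y ^ (t + 1) - y)) (y ^ t) := by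
  classical
  have hx : (y ^ (t + 1) - 1) / (y ^ (t + 1) - y) - 1 = (y - 1) / (y * (y ^ t - 1)) := by
    have : y ^ (t + 1) - y = y * (y ^ t - 1) := by ring
    rw [this]
    field_simp
    ring
  have huniv : (Finset.univ : Finset (E × Fin t)).image Prod.fst = Finset.univ := by
    have : Nonempty (Fin t) := ⟨⟨0, ht⟩⟩
    exact Finset.image_univ_of_surjective Prod.fst_surjective
  unfold tutte
  rw [hx, Finset.mul_sum, Finset.powerset_univ, Finset.powerset_univ,
    ← Finset.sum_fiberwise Finset.univ (fun A : Finset (E × Fin t) => A.image Prod.fst)]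
  refine Finset.sum_congr rfl fun B _ => ?_
  have hterm : ∀ A ∈ (Finset.univ : Finset (Finset (E × Fin t))).filter
      (fun A => A.image Prod.fst = B),
      (1 + 1 / y - 1) ^ (rank (fun p : E × Fin t => ends p.1) Finset.univ
          - rank (fun p : E × Fin t => ends p.1) A)
        * (y - 1) ^ (A.card - rank (fun p : E × Fin t => ends p.1) A)
      = (1 / y) ^ (rank ends Finset.univ - rank ends B) / (y - 1) ^ rank ends B
        * (y - 1) ^ A.card := by
    intro A hA
    have hle := rank_le_card (fun p : E × Fin t => ends p.1) A
    have hA' : rank (fun p : E × Fin t => ends p.1) A = rank ends B := by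
      rw [rank_comp ends Prod.fst, (Finset.mem_filter.1 hA).2]
    rw [hA'] at hle ⊢
    rw [rank_comp ends Prod.fst, huniv, add_sub_cancel_left, pow_sub₀ _ hy1 hle]
    ring
  rw [Finset.sum_congr rfl hterm, ← Finset.mul_sum, sum_pow_card_of_image_fst_eq,
    sub_add_cancel, Fintype.card_fin]
  obtain ⟨d, hd⟩ := Nat.exists_eq_add_of_le (rank_mono ends (Finset.subset_univ B))
  obtain ⟨k, hk⟩ := Nat.exists_eq_add_of_le (rank_le_card ends B)
  rw [hd, hk]
  simp only [Nat.add_sub_cancel_left, div_pow, mul_pow, pow_add, one_pow]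
  field_simp

/-- Let `G` be a finite multigraph and `t ≥ 1`. As an
identity of rational functions in `y` (elements of `RatFunc ℚ` with `y = X`),
`T_Ĝ(1 + 1/y, y) = ((y^t - 1)/(y - 1))^{v(G) - c(G)} · T_G((y^{t+1} - 1)/(y^{t+1} - y), y^t)`,
where `Ĝ` replaces every edge of `G` by `t` parallel copies. -/
theorem tutte_hat_eq_tutte_subst {U E : Type} [Finite U] [Fintype E]
    (t : ℕ) (ht : 1 ≤ t) (ends : E → Sym2 U) :
    tutte (V := U) (fun p : E × Fin t => ends p.1)
        (1 + 1 / RatFunc.X) (RatFunc.X : RatFunc ℚ)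
      = ((RatFunc.X ^ t - 1) / (RatFunc.X - 1)) ^
          (Nat.card U - numComponents ends Finset.univ)
        * tutte ends
            ((RatFunc.X ^ (t + 1) - 1) / (RatFunc.X ^ (t + 1) - RatFunc.X))
            ((RatFunc.X : RatFunc ℚ) ^ t) := by
  have hpow : ∀ n : ℕ, 1 ≤ n → (RatFunc.X : RatFunc ℚ) ^ n - 1 ≠ 0 := by
    intro n hn h
    apply Polynomial.X_pow_sub_C_ne_zero (R := ℚ) hn 1
    apply RatFunc.algebraMap_injective ℚ
    simpa using h
  exact tutte_parallel_eq ht ends RatFunc.X_ne_zero (by simpa using hpow 1 le_rfl) (hpow t ht)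

end ForestAlg
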